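/- arXiv:2008.05857 — 2 statements merged into one kernel-verified Lean document; each statement's English description precedes it below -/
import Mathlib

section
/- Let λ : D₁ → ℂ^× be a group homomorphism (a linear character of D₁) which is E-stable, i.e. λ(e•d) = λ(d) for every e ∈ E and every d ∈ D₁. Then λ is the trivial character, λ(d) = 1 for all d ∈ D₁. -/
theorem smul_mem_closure_inv_mul_smul {E D : Type*} [Group E] [CommGroup D]
    [MulDistribMulAction E D] (e : E) {d : D}
    (hd : d ∈ Subgroup.closure {x : D | ∃ (e : E) (d : D), x = d⁻¹ * (e • d)}) :
    e • d ∈ Subgroup.closure {x : D | ∃ (e : E) (d : D), x = d⁻¹ * (e • d)} := by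
  rw [← mul_inv_cancel_left d (e • d)]
  exact mul_mem hd (Subgroup.subset_closure ⟨e, d, rfl⟩)

theorem prod_smul_eq_one_of_mem_closure {E D : Type*} [Group E] [Fintype E] [CommGroup D]
    [MulDistribMulAction E D] {d : D}
    (hd : d ∈ Subgroup.closure {x : D | ∃ (e : E) (d : D), x = d⁻¹ * (e • d)}) :
    ∏ g : E, g • d = 1 := by
  induction hd using Subgroup.closure_induction with
  | mem x hx =>
    obtain ⟨e, d, rfl⟩ := hx
    simp only [smul_mul', smul_inv', Finset.prod_mul_distrib, Finset.prod_inv_distrib, ← mul_smul]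
    rw [inv_mul_eq_one]
    exact (Fintype.prod_equiv (Equiv.mulRight e) _ _ fun _ => rfl).symm
  | one => simp
  | mul x y _ _ hx hy => simp [smul_mul', Finset.prod_mul_distrib, hx, hy]
  | inv x _ hx => simp [smul_inv', hx]

/-- Let `D` be a finite abelian `p`-group, `E` a finite group of order
coprime to `p` acting on `D` by group automorphisms, and let `D₁ = [D, E]` be the
subgroup generated by all `d⁻¹ * (e • d)`.  If `λ : D₁ → ℂˣ` is an `E`-stable linear
character, then `λ` is trivial. -/
theorem linear_character_of_commutator_subgroup_stable_eq_one
    (p : ℕ) (hp : p.Prime)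
    (D : Type) [CommGroup D] [Finite D] (hD : IsPGroup p D)
    (E : Type) [Group E] [Finite E] (hE : Nat.Coprime (Nat.card E) p)
    [MulDistribMulAction E D]
    (lam : ↥(Subgroup.closure {x : D | ∃ (e : E) (d : D), x = d⁻¹ * (e • d)}) →* ℂˣ)
    (hstable : ∀ (e : E) (d : D)
      (hd : d ∈ Subgroup.closure {x : D | ∃ (e : E) (d : D), x = d⁻¹ * (e • d)})
      (hd' : e • d ∈ Subgroup.closure {x : D | ∃ (e : E) (d : D), x = d⁻¹ * (e • d)}),
      lam ⟨e • d, hd'⟩ = lam ⟨d, hd⟩) :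
    ∀ d, lam d = 1 := by
  rintro ⟨d, hd⟩
  have := Fintype.ofFinite E
  have hcard : lam ⟨d, hd⟩ ^ Nat.card E = 1 := by
    have hprod : ∏ g : E, (⟨g • d, smul_mem_closure_inv_mul_smul g hd⟩ :
        ↥(Subgroup.closure {x : D | ∃ (e : E) (d : D), x = d⁻¹ * (e • d)})) = 1 :=
      Subtype.ext (by simpa using prod_smul_eq_one_of_mem_closure hd)
    have := congrArg lam hprod
    simpa [map_prod, hstable _ d hd] using this
  obtain ⟨k, hk⟩ := hD d
  have hpow : lam ⟨d, hd⟩ ^ p ^ k = 1 := by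
    rw [← map_pow, show (⟨d, hd⟩ : ↥(Subgroup.closure _)) ^ p ^ k = 1 from Subtype.ext hk, map_one]
  rw [← orderOf_eq_one_iff]
  exact Nat.eq_one_of_dvd_coprimes (hE.pow_right k) (orderOf_dvd_of_pow_eq_one hcard)
    (orderOf_dvd_of_pow_eq_one hpow)
end

section
/- Let D be a finite p-group and φ an automorphism of D whose order is coprime to p. If φ(d)·d^{-1} lies in the commutator subgroup [D, D] for every d ∈ D (i.e. φ induces the identity on the abelianisation D/[D,D]), then φ is the identity automorphism of D. -/
open scoped commutatorElement in
/-- An endomorphism moving every element by a central element fixes the commutator subgroup. -/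
theorem MonoidHom.apply_eq_self_of_mem_commutator {G : Type*} [Group G] (f : G →* G)
    (hf : ∀ g, g⁻¹ * f g ∈ Subgroup.center G) {x : G} (hx : x ∈ commutator G) : f x = x := by
  have hle : commutator G ≤ f.eqLocus (MonoidHom.id G) := by
    rw [commutator_def, Subgroup.commutator_le]
    intro a _ b _
    have key : ∀ u v : G, u ∈ Subgroup.center G → v ∈ Subgroup.center G →
        ⁅a * u, b * v⁆ = ⁅a, b⁆ := by
      intro u v hu hv
      have h₁ : a * u * (b * v) = a * b * (u * v) := by
        rw [mul_assoc, ← mul_assoc u, (Subgroup.mem_center_iff.mp hu b).symm]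
        simp only [mul_assoc]
      have h₂ : b * v * (a * u) = b * a * (u * v) := by
        rw [mul_assoc, ← mul_assoc v, (Subgroup.mem_center_iff.mp hv a).symm]
        simp only [mul_assoc, Subgroup.mem_center_iff.mp hv u]
      rw [commutatorElement_def, commutatorElement_def, mul_assoc, ← mul_inv_rev, h₁, h₂]
      group
    change f ⁅a, b⁆ = ⁅a, b⁆
    simpa [map_commutatorElement] using key _ _ (hf a) (hf b)
  exact hle hx

/-- If `f g = g * c` and `f` fixes `c`, then `f^[n] g = g * c ^ n`. -/
theorem MonoidHom.iterate_apply_eq_mul_pow {G : Type*} [Group G] (f : G →* G) {g c : G}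
    (hg : f g = g * c) (hc : f c = c) (n : ℕ) : f^[n] g = g * c ^ n := by
  induction n with
  | zero => simp
  | succ n ih => rw [Function.iterate_succ_apply', ih, map_mul, map_pow, hg, hc, mul_assoc,
      pow_succ']

/-- An automorphism of a nilpotent `p`-group whose order divides an integer coprime to `p` and
which acts trivially on the abelianization is trivial. -/
theorem IsPGroup.mulEquiv_apply_eq_self_of_iterate_eq {p n : ℕ} (hn : p.Coprime n)
    {G : Type*} [Group G] [Group.IsNilpotent G] (hG : IsPGroup p G) (φ : G ≃* G)
    (hφ : ∀ g, φ^[n] g = g) (h : ∀ g, g⁻¹ * φ g ∈ commutator G) (g : G) : φ g = g := by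
  refine Group.nilpotent_center_quotient_ind
    (P := fun G _ _ => IsPGroup p G → ∀ φ : G ≃* G, (∀ g, φ^[n] g = g) →
      (∀ g, g⁻¹ * φ g ∈ commutator G) → ∀ g, φ g = g) G ?_ ?_ hG φ hφ h g
  · intro G _ _ _ φ _ _ g
    exact Subsingleton.elim _ _
  · intro G _ _ ih hG φ hφ h g
    let ψ : G ⧸ Subgroup.center G ≃* G ⧸ Subgroup.center G :=
      QuotientGroup.congr _ _ φ
        (Subgroup.characteristic_iff_map_eq.mp inferInstance φ)
    have hψ : ∀ x : G, ψ (x : G ⧸ Subgroup.center G) = (φ x : G) := fun _ => rfl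
    have hcenter : ∀ x : G, x⁻¹ * φ x ∈ Subgroup.center G := by
      intro x
      rw [← QuotientGroup.eq, ← hψ]
      refine (ih (hG.to_quotient _) ψ (fun y => ?_) (fun y => ?_) _).symm
      · induction y using QuotientGroup.induction_on with
        | H y =>
          have hs : Function.Semiconj (QuotientGroup.mk : G → G ⧸ Subgroup.center G) φ ψ :=
            fun _ => rfl
          rw [← (hs.iterate_right n).eq, hφ]
      · induction y using QuotientGroup.induction_on with
        | H y =>
          have hle : (commutator G).map (QuotientGroup.mk' (Subgroup.center G)) ≤
              commutator (G ⧸ Subgroup.center G) := by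
            rw [commutator_def, commutator_def, Subgroup.map_commutator]
            exact Subgroup.commutator_mono le_top le_top
          exact hle (Subgroup.mem_map_of_mem _ (h y))
    have hfix := φ.toMonoidHom.apply_eq_self_of_mem_commutator hcenter (h g)
    have hit := φ.toMonoidHom.iterate_apply_eq_mul_pow (g := g)
      (mul_inv_cancel_left g (φ g)).symm hfix n
    have hpow : (g⁻¹ * φ g) ^ n = 1 := by
      have hit' : g = g * (g⁻¹ * φ g) ^ n := (hφ g).symm.trans hit
      exact mul_eq_left.mp hit'.symm
    have hone : g⁻¹ * φ g = 1 :=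
      (hG.powEquiv hn).injective (by simpa using hpow)
    exact (inv_mul_eq_one.mp hone).symm

/-- Let `D` be a finite `p`-group and `φ` an automorphism of `D` whose
order is coprime to `p`. If `φ d * d⁻¹ ∈ [D, D]` for every `d` (i.e. `φ` induces the
identity on the abelianisation), then `φ` is the identity automorphism. -/
theorem mulAut_eq_one_of_coprime_orderOf_of_commutator
    (p : ℕ) (hp : p.Prime) (D : Type) [Group D] [Finite D] (hD : IsPGroup p D)
    (φ : MulAut D) (hord : Nat.Coprime (orderOf φ) p)
    (h : ∀ d : D, φ d * d⁻¹ ∈ commutator D) :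
    φ = MulEquiv.refl D := by
  have : Fact p.Prime := ⟨hp⟩
  have : Group.IsNilpotent D := hD.isNilpotent
  ext d
  refine hD.mulEquiv_apply_eq_self_of_iterate_eq hord.symm φ (fun g => ?_) (fun g => ?_) d
  · have hpow : ∀ k : ℕ, (φ ^ k) g = φ^[k] g := by
      intro k
      induction k with
      | zero => rfl
      | succ k ih => rw [pow_succ', MulAut.mul_apply, ih, Function.iterate_succ_apply']
    rw [← hpow, pow_orderOf_eq_one, MulAut.one_apply]
  · exact (inferInstance : (commutator D).Normal).mem_comm (h g)
end
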